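/- Let n ≥ 1 and let r be a real number that is not a nonnegative integer. There do not exist an open neighborhood Ω of 0 in ℝⁿ with 1 + 2Σ_{i=1}^n ξᵢηᵢ > 0 for all ξ, η ∈ Ω, a natural number N, and functions u_α, v_α : Ω → ℝ (α = 1,…,N) such that (1/2)·(1 + 2Σ_{i=1}^n ξᵢηᵢ)^r − 1/2 = Σ_{α=1}^N u_α(ξ)v_α(η) for all (ξ,η) ∈ Ω × Ω. -/

import Mathlib

open Set

/-- A linear relation among the functions `s ↦ (1 + 2 s tⱼ) ^ r` near `0` may be differentiated
term by term: each derivative yields a relation with coefficients `cⱼ tⱼ ^ k`. -/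
lemma sum_mul_pow_mul_rpow_eq_zero {ι : Type*} [Fintype ι] {r ε : ℝ}
    (hr : ∀ d : ℕ, r ≠ (d : ℝ)) {c t : ι → ℝ}
    (hpos : ∀ s ∈ Ioo (-ε) ε, ∀ j, 0 < 1 + 2 * (s * t j))
    (h : ∀ s ∈ Ioo (-ε) ε, ∑ j, c j * (1 + 2 * (s * t j)) ^ r = 0) (k : ℕ) :
    ∀ s ∈ Ioo (-ε) ε, ∑ j, c j * t j ^ k * (1 + 2 * (s * t j)) ^ (r - k) = 0 := by
  induction k with
  | zero => simpa using h
  | succ k ih =>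
    intro s hs
    have hderiv : HasDerivAt (fun s ↦ ∑ j, c j * t j ^ k * (1 + 2 * (s * t j)) ^ (r - k))
        (∑ j, c j * t j ^ k * (2 * (1 * t j) * (r - k) * (1 + 2 * (s * t j)) ^ (r - k - 1))) s :=
      HasDerivAt.fun_sum fun j _ ↦
        (((((hasDerivAt_id s).mul_const (t j)).const_mul 2).const_add 1).rpow_const
          (Or.inl (hpos s hs j).ne')).const_mul _
    have hzero := hderiv.unique <| (hasDerivAt_const s (0 : ℝ)).congr_of_eventuallyEq <|
      Filter.eventuallyEq_of_mem (isOpen_Ioo.mem_nhds hs) ih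
    have hfactor : 2 * (r - k) * ∑ j, c j * t j ^ (k + 1) *
        (1 + 2 * (s * t j)) ^ (r - (k + 1 : ℕ)) = 0 := by
      rw [← hzero, Finset.mul_sum]
      refine Finset.sum_congr rfl fun j _ ↦ ?_
      rw [Nat.cast_succ, ← sub_sub]
      ring
    exact (mul_eq_zero.mp hfactor).resolve_left
      (mul_ne_zero two_ne_zero (sub_ne_zero.mpr (hr k)))

/-- For `r` not a natural number, `(1 + 2 s t) ^ r` has no finite separable decomposition
near the origin. -/
lemma not_separable_one_add_mul_rpow {r ε : ℝ} (hr : ∀ d : ℕ, r ≠ (d : ℝ)) (hε : 0 < ε)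
    (hpos : ∀ s ∈ Ioo (-ε) ε, ∀ t ∈ Ioo (-ε) ε, 0 < 1 + 2 * (s * t))
    {N : ℕ} (u v : ℝ → Fin N → ℝ) :
    ¬ ∀ s ∈ Ioo (-ε) ε, ∀ t ∈ Ioo (-ε) ε, (1 + 2 * (s * t)) ^ r = ∑ α, u s α * v t α := by
  intro h
  have hε' : (Ioo (-ε) ε).Infinite := Ioo_infinite (by linarith)
  let t : Fin (N + 1) → ℝ := fun j ↦ hε'.natEmbedding _ j
  have ht : ∀ j, t j ∈ Ioo (-ε) ε := fun j ↦ (hε'.natEmbedding _ j).2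
  have htinj : Function.Injective t := fun i j hij ↦
    Fin.ext ((hε'.natEmbedding _).injective (Subtype.ext hij))
  obtain ⟨c, hc, hc0⟩ := Submodule.exists_mem_ne_zero_of_ne_bot <|
    LinearMap.ker_ne_bot_of_finrank_lt
      (f := (Matrix.of fun (α : Fin N) (j : Fin (N + 1)) ↦ v (t j) α).mulVecLin) (by simp)
  have hv : ∀ α, ∑ j, v (t j) α * c j = 0 := fun α ↦ congrFun (LinearMap.mem_ker.mp hc) α
  have hrel : ∀ s ∈ Ioo (-ε) ε, ∑ j, c j * (1 + 2 * (s * t j)) ^ r = 0 := by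
    intro s hs
    calc ∑ j, c j * (1 + 2 * (s * t j)) ^ r = ∑ j, ∑ α, u s α * (v (t j) α * c j) := by
          refine Finset.sum_congr rfl fun j _ ↦ ?_
          rw [h s hs _ (ht j), Finset.mul_sum]
          exact Finset.sum_congr rfl fun α _ ↦ by ring
      _ = ∑ α, u s α * ∑ j, v (t j) α * c j := by
          rw [Finset.sum_comm]
          simp_rw [Finset.mul_sum]
      _ = 0 := by simp [hv]
  refine hc0 (Matrix.eq_zero_of_forall_pow_sum_mul_pow_eq_zero htinj fun k ↦ ?_)
  simpa using sum_mul_pow_mul_rpow_eq_zero hr (fun s hs j ↦ hpos s hs _ (ht j)) hrel k 0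
    ⟨by linarith, hε⟩

/-- When r = b/c is not a nonnegative integer, the function
(1/2)(1 + 2Σξᵢηᵢ)^r − 1/2 admits no finite separable decomposition on any
neighborhood of 0. -/
theorem nonintegral_ratio_impossible (n : ℕ) (hn : 1 ≤ n) (r : ℝ)
    (hr : ∀ d : ℕ, r ≠ (d : ℝ)) :
    ¬ ∃ (Ω : Set (Fin n → ℝ)) (_ : IsOpen Ω) (_ : (0 : Fin n → ℝ) ∈ Ω)
        (_ : ∀ ξ ∈ Ω, ∀ η ∈ Ω, (0 : ℝ) < 1 + 2 * ∑ i, ξ i * η i)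
        (N : ℕ) (u v : (Fin n → ℝ) → Fin N → ℝ),
      ∀ ξ ∈ Ω, ∀ η ∈ Ω,
        (1 / 2) * (1 + 2 * ∑ i, ξ i * η i) ^ r - 1 / 2 = ∑ α, u ξ α * v η α := by
  rintro ⟨Ω, hΩ, h0, hpos, N, u, v, h⟩
  let e : ℝ → Fin n → ℝ := fun s ↦ Pi.single ⟨0, hn⟩ s
  have he : ∀ s t, ∑ i, e s i * e t i = s * t := fun s t ↦ by
    simp [e, Pi.single_apply]
  obtain ⟨ε, hε, hball⟩ := Metric.isOpen_iff.mp hΩ 0 h0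
  have hmem : ∀ s ∈ Ioo (-ε) ε, e s ∈ Ω := fun s hs ↦ hball <| by
    rw [mem_ball_zero_iff, Pi.norm_single]
    exact abs_lt.mpr hs
  refine not_separable_one_add_mul_rpow hr hε
    (fun s hs t ht ↦ by simpa only [he] using hpos _ (hmem s hs) _ (hmem t ht))
    (fun s ↦ (Fin.cons 1 fun α ↦ 2 * u (e s) α : Fin (N + 1) → ℝ))
    (fun t ↦ (Fin.cons 1 (v (e t)) : Fin (N + 1) → ℝ)) fun s hs t ht ↦ ?_
  have hst := h _ (hmem s hs) _ (hmem t ht)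
  rw [he] at hst
  simp only [Fin.sum_univ_succ, Fin.cons_zero, Fin.cons_succ, mul_assoc, ← Finset.mul_sum, ← hst]
  ring
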